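/- arXiv:1910.06123 — 8 statements merged into one kernel-verified Lean document; each statement's English description precedes it below -/
import Mathlib

section
/- (Theorem: Compatibility I) Let L be an orthomodular lattice and a, b : L. Then the sublattice of L generated by the set {a, aᶜ, b, bᶜ} is distributive (i.e., for all x, y, z in the lattice closure of {a, aᶜ, b, bᶜ} one has x ⊓ (y ⊔ z) = (x ⊓ y) ⊔ (x ⊓ z)) if and only if (a ⊓ b) ⊔ (aᶜ ⊓ b) = b. -/
/-- `c` is an orthocomplementation on `L` satisfying the orthomodular law. -/
structure IsOrthomodularCompl {L : Type*} [Lattice L] [BoundedOrder L] (c : L → L) : Prop where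
  inf_eq_bot : ∀ a : L, a ⊓ c a = ⊥
  sup_eq_top : ∀ a : L, a ⊔ c a = ⊤
  invol : ∀ a : L, c (c a) = a
  anti : ∀ a b : L, a ≤ b → c b ≤ c a
  orthomodular : ∀ a b : L, a ≤ b → a ⊔ (c a ⊓ b) = b

/-- `y` commutes with `x`: it is the join of its parts below `x` and below `c x`. -/
def OrthoCommutes {L : Type*} [Lattice L] (c : L → L) (y x : L) : Prop :=
  (y ⊓ x) ⊔ (y ⊓ c x) = y

namespace IsOrthomodularCompl

variable {L : Type*} [Lattice L] [BoundedOrder L] {c : L → L} {x y z : L}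

theorem compl_sup (hc : IsOrthomodularCompl c) (x y : L) : c (x ⊔ y) = c x ⊓ c y := by
  refine le_antisymm (le_inf (hc.anti _ _ le_sup_left) (hc.anti _ _ le_sup_right)) ?_
  have h : x ⊔ y ≤ c (c x ⊓ c y) := by
    refine sup_le ?_ ?_
    · simpa only [hc.invol] using hc.anti _ _ (inf_le_left : c x ⊓ c y ≤ c x)
    · simpa only [hc.invol] using hc.anti _ _ (inf_le_right : c x ⊓ c y ≤ c y)
  simpa only [hc.invol] using hc.anti _ _ h

theorem compl_inf (hc : IsOrthomodularCompl c) (x y : L) : c (x ⊓ y) = c x ⊔ c y := by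
  have h := hc.compl_sup (c x) (c y)
  rw [hc.invol, hc.invol] at h
  rw [← h, hc.invol]

theorem inf_compl_inf (hc : IsOrthomodularCompl c) (h : OrthoCommutes c y x) :
    x ⊓ c (x ⊓ y) = x ⊓ c y := by
  have hy : c y = c (y ⊓ x) ⊓ (c y ⊔ x) := by
    conv_lhs => rw [← h, hc.compl_sup, hc.compl_inf y (c x), hc.invol]
  rw [hy, inf_comm (c (y ⊓ x)), ← inf_assoc, inf_eq_left.mpr (le_sup_right : x ≤ c y ⊔ x),
    inf_comm y x]

theorem commutes_symm (hc : IsOrthomodularCompl c) (h : OrthoCommutes c y x) :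
    OrthoCommutes c x y := by
  have h' := hc.orthomodular (x ⊓ y) x inf_le_left
  rwa [inf_comm (c (x ⊓ y)), hc.inf_compl_inf h] at h'

theorem commutes_compl_right (hc : IsOrthomodularCompl c) (h : OrthoCommutes c y x) :
    OrthoCommutes c y (c x) := by
  unfold OrthoCommutes at *
  rwa [hc.invol, sup_comm]

theorem commutes_compl_left (hc : IsOrthomodularCompl c) (h : OrthoCommutes c y x) :
    OrthoCommutes c (c y) x :=
  hc.commutes_symm (hc.commutes_compl_right (hc.commutes_symm h))

theorem commutes_self (hc : IsOrthomodularCompl c) (x : L) : OrthoCommutes c x x := by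
  simp [OrthoCommutes, hc.inf_eq_bot]

/-- An element distributes over the join of two elements that commute with it
(Foulis–Holland). -/
theorem inf_sup_of_commutes (hc : IsOrthomodularCompl c) (hy : OrthoCommutes c y x)
    (hz : OrthoCommutes c z x) : x ⊓ (y ⊔ z) = (x ⊓ y) ⊔ (x ⊓ z) := by
  have hle : (x ⊓ y) ⊔ (x ⊓ z) ≤ x ⊓ (y ⊔ z) := le_inf_sup
  have hbot : c ((x ⊓ y) ⊔ (x ⊓ z)) ⊓ (x ⊓ (y ⊔ z)) = ⊥ := by
    calc c ((x ⊓ y) ⊔ (x ⊓ z)) ⊓ (x ⊓ (y ⊔ z))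
        = (x ⊓ c (x ⊓ y)) ⊓ (x ⊓ c (x ⊓ z)) ⊓ (y ⊔ z) := by
          rw [hc.compl_sup, ← inf_inf_distrib_left, ← inf_assoc, inf_comm _ x]
      _ = x ⊓ ((y ⊔ z) ⊓ c (y ⊔ z)) := by
          rw [hc.inf_compl_inf hy, hc.inf_compl_inf hz, ← inf_inf_distrib_left, ← hc.compl_sup,
            inf_assoc, inf_comm (c (y ⊔ z))]
      _ = ⊥ := by rw [hc.inf_eq_bot, inf_bot_eq]
  have h := hc.orthomodular _ _ hle
  rw [hbot, sup_bot_eq] at h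
  exact h.symm

theorem commutes_sup (hc : IsOrthomodularCompl c) (hy : OrthoCommutes c y x)
    (hz : OrthoCommutes c z x) : OrthoCommutes c (y ⊔ z) x := by
  unfold OrthoCommutes
  rw [inf_comm _ x, inf_comm _ (c x), hc.inf_sup_of_commutes hy hz,
    hc.inf_sup_of_commutes (hc.commutes_compl_right hy) (hc.commutes_compl_right hz),
    sup_sup_sup_comm, inf_comm x, inf_comm x, inf_comm (c x), inf_comm (c x), hy, hz]

theorem commutes_inf (hc : IsOrthomodularCompl c) (hy : OrthoCommutes c y x)
    (hz : OrthoCommutes c z x) : OrthoCommutes c (y ⊓ z) x := by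
  have h := hc.commutes_compl_left
    (hc.commutes_sup (hc.commutes_compl_left hy) (hc.commutes_compl_left hz))
  rwa [hc.compl_sup, hc.invol, hc.invol] at h

theorem isSublattice_commutes (hc : IsOrthomodularCompl c) (x : L) :
    IsSublattice {y | OrthoCommutes c y x} :=
  ⟨fun _ hy _ hz ↦ hc.commutes_sup hy hz, fun _ hy _ hz ↦ hc.commutes_inf hy hz⟩

/-- Pairwise commuting generators generate a sublattice whose elements commute pairwise. -/
theorem commutes_of_mem_latticeClosure (hc : IsOrthomodularCompl c) {s : Set L}
    (hs : ∀ x ∈ s, ∀ y ∈ s, OrthoCommutes c y x) (hx : x ∈ latticeClosure s)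
    (hy : y ∈ latticeClosure s) : OrthoCommutes c y x := by
  have key : ∀ w ∈ s, ∀ v ∈ latticeClosure s, OrthoCommutes c v w := fun w hw _ hv ↦
    latticeClosure_min (fun u hu ↦ hs w hw u hu) (hc.isSublattice_commutes w) hv
  exact hc.commutes_symm <|
    latticeClosure_min (fun w hw ↦ hc.commutes_symm (key w hw y hy))
      (hc.isSublattice_commutes y) hx

end IsOrthomodularCompl

/-- **Compatibility I.** In an orthomodular lattice, the sublattice generated by
`{a, aᶜ, b, bᶜ}` is distributive iff `(a ⊓ b) ⊔ (aᶜ ⊓ b) = b`. -/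
theorem compatibility_I {L : Type*} [Lattice L] [BoundedOrder L] (compl : L → L)
    (h_inf : ∀ a : L, a ⊓ compl a = ⊥)
    (h_sup : ∀ a : L, a ⊔ compl a = ⊤)
    (h_invol : ∀ a : L, compl (compl a) = a)
    (h_anti : ∀ a b : L, a ≤ b → compl b ≤ compl a)
    (h_om : ∀ a b : L, a ≤ b → a ⊔ (compl a ⊓ b) = b)
    (a b : L) :
    (∀ x ∈ latticeClosure {a, compl a, b, compl b},
      ∀ y ∈ latticeClosure {a, compl a, b, compl b},
        ∀ z ∈ latticeClosure {a, compl a, b, compl b},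
          x ⊓ (y ⊔ z) = (x ⊓ y) ⊔ (x ⊓ z)) ↔
      (a ⊓ b) ⊔ (compl a ⊓ b) = b := by
  have hc : IsOrthomodularCompl compl := ⟨h_inf, h_sup, h_invol, h_anti, h_om⟩
  constructor
  · intro h
    have h' := h b (subset_latticeClosure (by simp)) a (subset_latticeClosure (by simp))
      (compl a) (subset_latticeClosure (by simp))
    rw [h_sup, inf_top_eq] at h'
    rw [inf_comm a, inf_comm (compl a)]
    exact h'.symm
  · intro h
    have hba : OrthoCommutes compl b a := by
      unfold OrthoCommutes
      rwa [inf_comm b, inf_comm b]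
    have hab := hc.commutes_symm hba
    have hgen : ∀ x ∈ ({a, compl a, b, compl b} : Set L),
        ∀ y ∈ ({a, compl a, b, compl b} : Set L), OrthoCommutes compl y x := by
      rintro x (rfl | rfl | rfl | rfl) y (rfl | rfl | rfl | rfl) <;>
        first
        | exact hc.commutes_self _
        | assumption
        | exact hc.commutes_compl_left (hc.commutes_self _)
        | exact hc.commutes_compl_right (hc.commutes_self _)
        | exact hc.commutes_compl_left ‹_›
        | exact hc.commutes_compl_right ‹_›
        | exact hc.commutes_compl_left (hc.commutes_compl_right ‹_›)
    intro x hx y hy z hz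
    exact hc.inf_sup_of_commutes (hc.commutes_of_mem_latticeClosure hgen hx hy)
      (hc.commutes_of_mem_latticeClosure hgen hx hz)
end

section
/- (Symmetry of compatibility) Let L be an orthomodular lattice and a, b : L. If (a ⊓ b) ⊔ (aᶜ ⊓ b) = b, then (a ⊓ b) ⊔ (a ⊓ bᶜ) = a. In particular, the compatibility relation is symmetric. -/
/-- **Symmetry of compatibility** in an orthomodular lattice. -/
theorem compat_symm {L : Type*} [Lattice L] [BoundedOrder L] (compl : L → L)
    (h_inf : ∀ a : L, a ⊓ compl a = ⊥)
    (h_sup : ∀ a : L, a ⊔ compl a = ⊤)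
    (h_invol : ∀ a : L, compl (compl a) = a)
    (h_anti : ∀ a b : L, a ≤ b → compl b ≤ compl a)
    (h_om : ∀ a b : L, a ≤ b → a ⊔ (compl a ⊓ b) = b)
    (a b : L) (h : (a ⊓ b) ⊔ (compl a ⊓ b) = b) :
    (a ⊓ b) ⊔ (a ⊓ compl b) = a := by
  have hb : b ≤ compl (compl (a ⊓ b) ⊓ a) := by
    have h₁ : a ⊓ b ≤ compl (compl (a ⊓ b) ⊓ a) := by
      simpa only [h_invol] using h_anti (compl (a ⊓ b) ⊓ a) _ inf_le_left
    have h₂ : compl a ⊓ b ≤ compl (compl (a ⊓ b) ⊓ a) :=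
      inf_le_left.trans (h_anti _ _ inf_le_right)
    exact h.ge.trans (sup_le h₁ h₂)
  have hx : compl (a ⊓ b) ⊓ a ≤ compl b := by
    simpa only [h_invol] using h_anti _ _ hb
  refine le_antisymm (sup_le inf_le_left inf_le_left) ?_
  calc a = (a ⊓ b) ⊔ (compl (a ⊓ b) ⊓ a) := (h_om _ _ inf_le_left).symm
    _ ≤ (a ⊓ b) ⊔ (a ⊓ compl b) := sup_le_sup_left (le_inf inf_le_right hx) _
end

section
/- (Intermediate step in the proof of Compatibility I) Let L be an orthomodular lattice and a, b : L. If (a ⊓ b) ⊔ (aᶜ ⊓ b) = b, then a ⊓ bᶜ = a ⊓ (a ⊓ b)ᶜ. -/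
/-- Intermediate step in the proof of Compatibility I. -/
theorem compat_inter_step {L : Type*} [Lattice L] [BoundedOrder L] (compl : L → L)
    (h_inf : ∀ a : L, a ⊓ compl a = ⊥)
    (h_sup : ∀ a : L, a ⊔ compl a = ⊤)
    (h_invol : ∀ a : L, compl (compl a) = a)
    (h_anti : ∀ a b : L, a ≤ b → compl b ≤ compl a)
    (h_om : ∀ a b : L, a ≤ b → a ⊔ (compl a ⊓ b) = b)
    (a b : L) (h : (a ⊓ b) ⊔ (compl a ⊓ b) = b) :
    a ⊓ compl b = a ⊓ compl (a ⊓ b) := by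
  refine le_antisymm (inf_le_inf_left a (h_anti _ _ inf_le_right)) (le_inf inf_le_left ?_)
  have hb : b ≤ compl (a ⊓ compl (a ⊓ b)) := by
    refine h.ge.trans (sup_le ?_ (inf_le_left.trans (h_anti _ _ inf_le_left)))
    simpa only [h_invol] using
      h_anti _ _ (inf_le_right : a ⊓ compl (a ⊓ b) ≤ compl (a ⊓ b))
  simpa only [h_invol] using h_anti _ _ hb
end

section
/- (Distributivity equation in the proof of Compatibility I) Let L be an orthomodular lattice and a, b : L. If (a ⊓ b) ⊔ (aᶜ ⊓ b) = b, then (a ⊓ b) ⊔ bᶜ = a ⊔ bᶜ. -/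
/-- Distributivity equation in the proof of Compatibility I. -/
theorem compat_distr_eq {L : Type*} [Lattice L] [BoundedOrder L] (compl : L → L)
    (h_inf : ∀ a : L, a ⊓ compl a = ⊥)
    (h_sup : ∀ a : L, a ⊔ compl a = ⊤)
    (h_invol : ∀ a : L, compl (compl a) = a)
    (h_anti : ∀ a b : L, a ≤ b → compl b ≤ compl a)
    (h_om : ∀ a b : L, a ≤ b → a ⊔ (compl a ⊓ b) = b)
    (a b : L) (h : (a ⊓ b) ⊔ (compl a ⊓ b) = b) :
    (a ⊓ b) ⊔ compl b = a ⊔ compl b := by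
  have le_compl_comm : ∀ x y : L, x ≤ compl y → y ≤ compl x := fun x y hxy => by
    simpa only [h_invol] using h_anti _ _ hxy
  have hy : a ⊔ compl b ≤ compl (compl a ⊓ b) :=
    sup_le (le_compl_comm _ _ inf_le_left) (h_anti _ _ inf_le_right)
  have hz : compl (a ⊓ b) ⊓ (a ⊔ compl b) ≤ compl b := by
    refine le_compl_comm _ _ (h.symm.le.trans (sup_le ?_ ?_))
    · exact le_compl_comm _ _ inf_le_left
    · exact le_compl_comm _ _ (inf_le_right.trans hy)
  refine le_antisymm (sup_le_sup_right inf_le_left _) ?_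
  calc a ⊔ compl b = (a ⊓ b) ⊔ (compl (a ⊓ b) ⊓ (a ⊔ compl b)) :=
        (h_om _ _ (inf_le_left.trans le_sup_left)).symm
    _ ≤ (a ⊓ b) ⊔ compl b := sup_le_sup_left hz _
end

section
/- (Theorem: Compatibility II) Let L be an orthomodular lattice and a, b : L. Then a and b are compatible (i.e., (a ⊓ b) ⊔ (aᶜ ⊓ b) = b) if and only if there exist mutually orthogonal elements a', b', c : L (i.e., a' ≤ b'ᶜ, a' ≤ cᶜ, b' ≤ cᶜ) such that a = a' ⊔ c and b = b' ⊔ c. -/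
/-- **Compatibility II.** `a` and `b` are compatible iff they decompose via
mutually orthogonal elements `a'`, `b'`, `c` as `a = a' ⊔ c` and `b = b' ⊔ c`. -/
theorem compatibility_II {L : Type*} [Lattice L] [BoundedOrder L] (compl : L → L)
    (h_inf : ∀ a : L, a ⊓ compl a = ⊥)
    (h_sup : ∀ a : L, a ⊔ compl a = ⊤)
    (h_invol : ∀ a : L, compl (compl a) = a)
    (h_anti : ∀ a b : L, a ≤ b → compl b ≤ compl a)
    (h_om : ∀ a b : L, a ≤ b → a ⊔ (compl a ⊓ b) = b)
    (a b : L) :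
    (a ⊓ b) ⊔ (compl a ⊓ b) = b ↔
      ∃ a' b' c : L, a' ≤ compl b' ∧ a' ≤ compl c ∧ b' ≤ compl c ∧
        a = a' ⊔ c ∧ b = b' ⊔ c := by
  have swap : ∀ {x y : L}, x ≤ compl y → y ≤ compl x := fun {x y} h => by
    simpa only [h_invol] using h_anti _ _ h
  constructor
  · intro h
    refine ⟨compl (a ⊓ b) ⊓ a, compl a ⊓ b, a ⊓ b, ?_, inf_le_left, ?_, ?_, ?_⟩
    · exact inf_le_right.trans (swap inf_le_left)
    · exact inf_le_left.trans (h_anti _ _ inf_le_left)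
    · rw [sup_comm, h_om _ _ inf_le_left]
    · rw [sup_comm, h]
  · rintro ⟨a', b', c, hab, -, hbc, ha, hb⟩
    have hb'a : b' ≤ compl a := swap (ha.trans_le (sup_le hab (swap hbc)))
    have hca : c ≤ a := le_sup_right.trans_eq ha.symm
    have hcb : c ≤ b := le_sup_right.trans_eq hb.symm
    have hb'b : b' ≤ b := le_sup_left.trans_eq hb.symm
    refine le_antisymm (sup_le inf_le_right inf_le_right) (hb.trans_le (sup_le ?_ ?_))
    · exact (le_inf hb'a hb'b).trans le_sup_right
    · exact (le_inf hca hcb).trans le_sup_left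
end

section
/- (Intermediate step in the proof of Compatibility II) Let L be an orthomodular lattice and let a', b', c : L be mutually orthogonal (a' ≤ b'ᶜ, a' ≤ cᶜ, b' ≤ cᶜ). Set a = a' ⊔ c and b = b' ⊔ c. Then aᶜ ⊓ b = b'. -/
/-- Intermediate step in the proof of Compatibility II: `aᶜ ⊓ b = b'`. -/
theorem compatII_step1 {L : Type*} [Lattice L] [BoundedOrder L] (compl : L → L)
    (h_inf : ∀ a : L, a ⊓ compl a = ⊥)
    (h_sup : ∀ a : L, a ⊔ compl a = ⊤)
    (h_invol : ∀ a : L, compl (compl a) = a)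
    (h_anti : ∀ a b : L, a ≤ b → compl b ≤ compl a)
    (h_om : ∀ a b : L, a ≤ b → a ⊔ (compl a ⊓ b) = b)
    (a' b' c : L) (hab : a' ≤ compl b') (hac : a' ≤ compl c) (hbc : b' ≤ compl c) :
    compl (a' ⊔ c) ⊓ (b' ⊔ c) = b' := by
  have swap : ∀ x y : L, x ≤ compl y → y ≤ compl x := fun x y h => by
    simpa only [h_invol] using h_anti _ _ h
  have b'_le : b' ≤ compl (a' ⊔ c) ⊓ (b' ⊔ c) :=
    le_inf (swap _ _ (sup_le hab (swap _ _ hbc))) le_sup_left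
  have de_morgan : compl b' ⊓ compl c ≤ compl (b' ⊔ c) :=
    swap _ _ (sup_le (swap _ _ inf_le_left) (swap _ _ inf_le_right))
  have inf_eq_bot : compl b' ⊓ (compl (a' ⊔ c) ⊓ (b' ⊔ c)) = ⊥ := by
    rw [eq_bot_iff, ← h_inf (b' ⊔ c)]
    refine le_inf (inf_le_right.trans inf_le_right) (le_trans ?_ de_morgan)
    exact inf_le_inf_left _ (inf_le_left.trans (h_anti _ _ le_sup_right))
  rw [← h_om _ _ b'_le, inf_eq_bot, sup_bot_eq]
end

section
/- (Intermediate step in the proof of Compatibility II) Let L be an orthomodular lattice and let a', b', c : L be mutually orthogonal (a' ≤ b'ᶜ, a' ≤ cᶜ, b' ≤ cᶜ). Set a = a' ⊔ c and b = b' ⊔ c. Then a ⊓ b = c. -/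
/-- In an orthomodular lattice, if `a` is orthogonal to `c`, then `(a ⊔ c) ⊓ cᶜ ≤ a`. -/
theorem compl_inf_sup_le_of_orthogonal {L : Type*} [Lattice L] (compl : L → L)
    (h_invol : ∀ a : L, compl (compl a) = a)
    (h_anti : ∀ a b : L, a ≤ b → compl b ≤ compl a)
    (h_om : ∀ a b : L, a ≤ b → a ⊔ (compl a ⊓ b) = b)
    (a c : L) (hac : a ≤ compl c) : compl c ⊓ (a ⊔ c) ≤ a := by
  have le_compl {x y : L} (h : x ≤ compl y) : y ≤ compl x := by
    simpa only [h_invol] using h_anti _ _ h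
  have hle : compl a ≤ compl (compl c ⊓ (a ⊔ c)) := by
    rw [← h_om c (compl a) (le_compl hac)]
    refine sup_le (le_compl inf_le_left) (le_compl (inf_le_right.trans ?_))
    exact sup_le (le_compl inf_le_right) (le_compl inf_le_left)
  simpa only [h_invol] using le_compl hle

/-- Intermediate step in the proof of Compatibility II: `a ⊓ b = c`. -/
theorem compatII_step2 {L : Type*} [Lattice L] [BoundedOrder L] (compl : L → L)
    (h_inf : ∀ a : L, a ⊓ compl a = ⊥)
    (h_sup : ∀ a : L, a ⊔ compl a = ⊤)
    (h_invol : ∀ a : L, compl (compl a) = a)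
    (h_anti : ∀ a b : L, a ≤ b → compl b ≤ compl a)
    (h_om : ∀ a b : L, a ≤ b → a ⊔ (compl a ⊓ b) = b)
    (a' b' c : L) (hab : a' ≤ compl b') (hac : a' ≤ compl c) (hbc : b' ≤ compl c) :
    (a' ⊔ c) ⊓ (b' ⊔ c) = c := by
  have key := compl_inf_sup_le_of_orthogonal compl h_invol h_anti h_om
  have hbot : compl c ⊓ ((a' ⊔ c) ⊓ (b' ⊔ c)) ≤ ⊥ := by
    rw [← h_inf b']
    refine le_inf ?_ (le_trans ?_ hab)
    · exact (inf_le_inf_left _ inf_le_right).trans (key b' c hbc)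
    · exact (inf_le_inf_left _ inf_le_left).trans (key a' c hac)
  rw [← h_om c _ (le_inf le_sup_right le_sup_right), le_bot_iff.mp hbot, sup_bot_eq]
end

section
/- (Distributive sublattice generated by two compatible elements) Let L be a bounded orthocomplemented lattice and a, b : L. Assume a ⊓ (aᶜ ⊔ b) = b and bᶜ ⊓ (b ⊔ aᶜ) = aᶜ. Then the set S = {⊥, a, aᶜ, b, bᶜ, a ⊓ bᶜ, aᶜ ⊔ b, ⊤} is closed under ⊓ and ⊔, contains {a, aᶜ, b, bᶜ}, equals the sublattice (lattice closure) generated by {a, aᶜ, b, bᶜ}, and is distributive: for all x, y, z ∈ S, x ⊓ (y ⊔ z) = (x ⊓ y) ⊔ (x ⊓ z). -/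
section Orthocomplement

variable {L : Type*} [Lattice L] (compl : L → L)

theorem compl_sup_of_involutive_of_antitone (h_invol : ∀ a : L, compl (compl a) = a)
    (h_anti : ∀ a b : L, a ≤ b → compl b ≤ compl a) (x y : L) :
    compl (x ⊔ y) = compl x ⊓ compl y := by
  refine le_antisymm (le_inf (h_anti _ _ le_sup_left) (h_anti _ _ le_sup_right)) ?_
  rw [← h_invol (compl x ⊓ compl y)]
  refine h_anti _ _ (sup_le ?_ ?_)
  · simpa only [h_invol] using h_anti _ _ (inf_le_left : compl x ⊓ compl y ≤ compl x)
  · simpa only [h_invol] using h_anti _ _ (inf_le_right : compl x ⊓ compl y ≤ compl y)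

theorem compl_inf_of_involutive_of_antitone (h_invol : ∀ a : L, compl (compl a) = a)
    (h_anti : ∀ a b : L, a ≤ b → compl b ≤ compl a) (x y : L) :
    compl (x ⊓ y) = compl x ⊔ compl y := by
  rw [← h_invol (compl x ⊔ compl y),
    compl_sup_of_involutive_of_antitone compl h_invol h_anti, h_invol, h_invol]

/-- If complementing a join of members of a finite family `g` gives the join of the remaining
members, then meets of such joins are computed on the index sets. -/
theorem Finset.sup_inter_of_compl {ι : Type*} [Fintype ι] [DecidableEq ι] [OrderBot L]
    (h_invol : ∀ a : L, compl (compl a) = a)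
    (h_anti : ∀ a b : L, a ≤ b → compl b ≤ compl a) (g : ι → L)
    (hg : ∀ s : Finset ι, compl (s.sup g) = sᶜ.sup g) (s t : Finset ι) :
    (s ∩ t).sup g = s.sup g ⊓ t.sup g := by
  rw [← h_invol (s.sup g ⊓ t.sup g), compl_inf_of_involutive_of_antitone compl h_invol h_anti,
    hg, hg, ← Finset.sup_union, hg, Finset.compl_union, compl_compl, compl_compl]

end Orthocomplement

/-- **Distributive sublattice generated by two compatible elements.** The set
`S = {⊥, a, aᶜ, b, bᶜ, a ⊓ bᶜ, aᶜ ⊔ b, ⊤}` is closed under `⊓` and `⊔`,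
contains `{a, aᶜ, b, bᶜ}`, equals the sublattice generated by
`{a, aᶜ, b, bᶜ}`, and is distributive. -/
theorem distributive_sublattice {L : Type*} [Lattice L] [BoundedOrder L] (compl : L → L)
    (h_inf : ∀ a : L, a ⊓ compl a = ⊥)
    (h_sup : ∀ a : L, a ⊔ compl a = ⊤)
    (h_invol : ∀ a : L, compl (compl a) = a)
    (h_anti : ∀ a b : L, a ≤ b → compl b ≤ compl a)
    (a b : L)
    (h1 : a ⊓ (compl a ⊔ b) = b)
    (h2 : compl b ⊓ (b ⊔ compl a) = compl a) :
    (∀ x ∈ ({⊥, a, compl a, b, compl b, a ⊓ compl b, compl a ⊔ b, ⊤} : Set L),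
      ∀ y ∈ ({⊥, a, compl a, b, compl b, a ⊓ compl b, compl a ⊔ b, ⊤} : Set L),
        x ⊓ y ∈ ({⊥, a, compl a, b, compl b, a ⊓ compl b, compl a ⊔ b, ⊤} : Set L) ∧
        x ⊔ y ∈ ({⊥, a, compl a, b, compl b, a ⊓ compl b, compl a ⊔ b, ⊤} : Set L)) ∧
    ({a, compl a, b, compl b} : Set L) ⊆
      ({⊥, a, compl a, b, compl b, a ⊓ compl b, compl a ⊔ b, ⊤} : Set L) ∧
    ({⊥, a, compl a, b, compl b, a ⊓ compl b, compl a ⊔ b, ⊤} : Set L) =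
      latticeClosure {a, compl a, b, compl b} ∧
    (∀ x ∈ ({⊥, a, compl a, b, compl b, a ⊓ compl b, compl a ⊔ b, ⊤} : Set L),
      ∀ y ∈ ({⊥, a, compl a, b, compl b, a ⊓ compl b, compl a ⊔ b, ⊤} : Set L),
        ∀ z ∈ ({⊥, a, compl a, b, compl b, a ⊓ compl b, compl a ⊔ b, ⊤} : Set L),
          x ⊓ (y ⊔ z) = (x ⊓ y) ⊔ (x ⊓ z)) := by
  have compl_sup := compl_sup_of_involutive_of_antitone compl h_invol h_anti
  have compl_inf := compl_inf_of_involutive_of_antitone compl h_invol h_anti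
  have compl_top : compl ⊤ = ⊥ := by simpa using h_inf ⊤
  have compl_bot : compl ⊥ = ⊤ := by simpa using h_sup ⊥
  have sup_eq_left : b ⊔ (a ⊓ compl b) = a := by
    simpa [compl_sup, compl_inf, h_invol, inf_comm] using congrArg compl h2
  have sup_eq_right : compl a ⊔ (a ⊓ compl b) = compl b := by
    simpa [compl_sup, compl_inf, h_invol] using congrArg compl h1
  have compl_sup_self : compl a ⊔ a = ⊤ := by rw [sup_comm, h_sup]
  let g : Fin 3 → L := ![compl a, b, a ⊓ compl b]
  have forall_finset (P : Finset (Fin 3) → Prop) (h : P ∅ ∧ P {0} ∧ P {1} ∧ P {2} ∧ P {0, 1} ∧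
      P {0, 2} ∧ P {1, 2} ∧ P {0, 1, 2}) (s : Finset (Fin 3)) : P s := by
    have : s = ∅ ∨ s = {0} ∨ s = {1} ∨ s = {2} ∨ s = {0, 1} ∨ s = {0, 2} ∨ s = {1, 2} ∨
        s = {0, 1, 2} := by
      revert s
      decide
    rcases this with rfl | rfl | rfl | rfl | rfl | rfl | rfl | rfl <;> tauto
  have g_compl (s : Finset (Fin 3)) : compl (s.sup g) = sᶜ.sup g := by
    refine forall_finset (fun s => compl (s.sup g) = sᶜ.sup g) ?_ s
    rw [show (∅ : Finset (Fin 3))ᶜ = {0, 1, 2} by decide,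
      show ({0} : Finset (Fin 3))ᶜ = {1, 2} by decide,
      show ({1} : Finset (Fin 3))ᶜ = {0, 2} by decide,
      show ({2} : Finset (Fin 3))ᶜ = {0, 1} by decide,
      show ({0, 1} : Finset (Fin 3))ᶜ = {2} by decide,
      show ({0, 2} : Finset (Fin 3))ᶜ = {1} by decide,
      show ({1, 2} : Finset (Fin 3))ᶜ = {0} by decide,
      show ({0, 1, 2} : Finset (Fin 3))ᶜ = ∅ by decide]
    simp [g, sup_eq_left, sup_eq_right, compl_bot, compl_sup, compl_inf, h_invol, compl_top,
      compl_sup_self]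
  have sup_inter := Finset.sup_inter_of_compl compl h_invol h_anti g g_compl
  have range_eq : ({⊥, a, compl a, b, compl b, a ⊓ compl b, compl a ⊔ b, ⊤} : Set L) =
      Set.range fun s : Finset (Fin 3) => s.sup g := by
    refine Set.Subset.antisymm ?_ (Set.range_subset_iff.2 (forall_finset _ ?_))
    · rintro x (rfl | rfl | rfl | rfl | rfl | rfl | rfl | rfl)
      exacts [⟨∅, by simp⟩, ⟨{1, 2}, by simp [g, sup_eq_left]⟩, ⟨{0}, by simp [g]⟩,
        ⟨{1}, by simp [g]⟩, ⟨{0, 2}, by simp [g, sup_eq_right]⟩, ⟨{2}, by simp [g]⟩,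
        ⟨{0, 1}, by simp [g]⟩, ⟨{0, 1, 2}, by simp [g, sup_eq_left, compl_sup_self]⟩]
    · simp [g, sup_eq_left, sup_eq_right, compl_sup_self]
  have gens_subset : ({a, compl a, b, compl b} : Set L) ⊆
      {⊥, a, compl a, b, compl b, a ⊓ compl b, compl a ⊔ b, ⊤} := by
    rintro x (rfl | rfl | rfl | rfl) <;> simp
  have sup_mem : SupClosed ({⊥, a, compl a, b, compl b, a ⊓ compl b, compl a ⊔ b, ⊤} : Set L) := by
    rw [range_eq]
    rintro _ ⟨s, rfl⟩ _ ⟨t, rfl⟩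
    exact ⟨s ∪ t, Finset.sup_union⟩
  have inf_mem : InfClosed ({⊥, a, compl a, b, compl b, a ⊓ compl b, compl a ⊔ b, ⊤} : Set L) := by
    rw [range_eq]
    rintro _ ⟨s, rfl⟩ _ ⟨t, rfl⟩
    exact ⟨s ∩ t, sup_inter s t⟩
  refine ⟨fun x hx y hy => ⟨inf_mem hx hy, sup_mem hx hy⟩, gens_subset,
    Set.Subset.antisymm ?_ (latticeClosure_min gens_subset ⟨sup_mem, inf_mem⟩), ?_⟩
  · have closed := isSublattice_latticeClosure (s := ({a, compl a, b, compl b} : Set L))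
    have ha : a ∈ latticeClosure {a, compl a, b, compl b} := subset_latticeClosure (by simp)
    have ha' : compl a ∈ latticeClosure {a, compl a, b, compl b} :=
      subset_latticeClosure (by simp)
    have hb : b ∈ latticeClosure {a, compl a, b, compl b} := subset_latticeClosure (by simp)
    have hb' : compl b ∈ latticeClosure {a, compl a, b, compl b} :=
      subset_latticeClosure (by simp)
    simp only [Set.insert_subset_iff, Set.singleton_subset_iff]
    exact ⟨h_inf a ▸ closed.infClosed ha ha', ha, ha', hb, hb', closed.infClosed ha hb',
      closed.supClosed ha' hb, h_sup a ▸ closed.supClosed ha ha'⟩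
  · rw [range_eq]
    rintro _ ⟨s, rfl⟩ _ ⟨t, rfl⟩ _ ⟨u, rfl⟩
    simp only [← Finset.sup_union, ← sup_inter, Finset.inter_union_distrib_left]
end
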